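/- Let w = s_{i_L}⋯s_{i_1} be a reduced word in the Weyl group W of A whose letters i_1,…,i_L are the first L terms of ι. Define f̃_i^{max}(x) = f̃_i^{φ_i(x)}(x). Then the element x_w := f̃_{i_L}^{max} f̃_{i_{L−1}}^{max} ⋯ f̃_{i_1}^{max}(0̄) of ℤ^∞_ι[λ] is nonzero and is the unique solution of the system of linear equations { x_k = 0 for all k > L, and β_k^{(−)}(x) = 0 for 1 ≤ k ≤ L }. (x_w is the image under the Kashiwara embedding Ψ_ι^{(λ)} of the extremal vector u_{wλ} ∈ B(λ) of weight wλ.) -/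

import Mathlib

noncomputable section

namespace PaperNakashima

variable {I : Type*} [DecidableEq I]

/-- `σ_k(x) = x_k + Σ_{j>k} a_{i_k i_j} x_j`. -/
def sig (A : I → I → ℤ) (ι : ℕ → I) (k : ℕ) (x : ℕ →₀ ℤ) : ℤ :=
  x k + ∑ j ∈ x.support.filter (fun j => k < j), A (ι k) (ι j) * x j

/-- `σ_0^{(i)}(x) = -λ_i + Σ_{j≥1} a_{i i_j} x_j`. -/
def sig0 (A : I → I → ℤ) (ι : ℕ → I) (lam : I → ℤ) (i : I) (x : ℕ →₀ ℤ) : ℤ :=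
  -lam i + ∑ j ∈ x.support.filter (fun j => 1 ≤ j), A i (ι j) * x j

/-- `σ^{(i)}(x) = max_{k ≥ 1, i_k = i} σ_k(x)`. -/
def sigMax (A : I → I → ℤ) (ι : ℕ → I) (i : I) (x : ℕ →₀ ℤ) : ℤ :=
  sSup ((fun k => sig A ι k x) '' {k | 1 ≤ k ∧ ι k = i})

/-- `M^{(i)}(x) = {k ≥ 1 : i_k = i, σ_k(x) = σ^{(i)}(x)}`. -/
def Mset (A : I → I → ℤ) (ι : ℕ → I) (i : I) (x : ℕ →₀ ℤ) : Set ℕ :=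
  {k | 1 ≤ k ∧ ι k = i ∧ sig A ι k x = sigMax A ι i x}

/-- The Kashiwara operator `f̃_i` on `ℤ^∞_ι[λ] ⊔ {0}`, with `none` playing the role of `0`. -/
def ftil (A : I → I → ℤ) (ι : ℕ → I) (lam : I → ℤ) (i : I) :
    Option (ℕ →₀ ℤ) → Option (ℕ →₀ ℤ)
  | none => none
  | some x =>
    if sig0 A ι lam i x < sigMax A ι i x then
      some (x + Finsupp.single (sInf (Mset A ι i x)) 1)
    else none

/-- The Kashiwara operator `ẽ_i` on `ℤ^∞_ι[λ] ⊔ {0}`. -/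
def etil (A : I → I → ℤ) (ι : ℕ → I) (lam : I → ℤ) (i : I) :
    Option (ℕ →₀ ℤ) → Option (ℕ →₀ ℤ)
  | none => none
  | some x =>
    if 0 < sigMax A ι i x ∧ sig0 A ι lam i x ≤ sigMax A ι i x then
      some (x - Finsupp.single (sSup (Mset A ι i x)) 1)
    else none

/-- `ε_i(x) = max(σ^{(i)}(x), σ_0^{(i)}(x))`. -/
def eps (A : I → I → ℤ) (ι : ℕ → I) (lam : I → ℤ) (i : I) (x : ℕ →₀ ℤ) : ℤ :=
  max (sigMax A ι i x) (sig0 A ι lam i x)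

/-- `φ_i(x) = ε_i(x) - σ_0^{(i)}(x) = ⟨h_i, wt(x)⟩ + ε_i(x)`. -/
def phi (A : I → I → ℤ) (ι : ℕ → I) (lam : I → ℤ) (i : I) (x : ℕ →₀ ℤ) : ℤ :=
  eps A ι lam i x - sig0 A ι lam i x

/-- `F(λ)`: the image of `B(λ)` under the Kashiwara embedding, i.e. all nonzero elements
obtained from the highest weight element `0̄` by applying Kashiwara operators `f̃`. -/
def FSet (A : I → I → ℤ) (ι : ℕ → I) (lam : I → ℤ) : Set (ℕ →₀ ℤ) :=
  {x | ∃ l : List I, List.foldl (fun y i => ftil A ι lam i y) (some 0) l = some x}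

/-- The Demazure subsets `D_k`: `D_0 = {0̄}` and
`D_k = { f̃_{i_k}^m(x) : m ≥ 0, x ∈ D_{k-1} } \ {0}`. -/
def Dem (A : I → I → ℤ) (ι : ℕ → I) (lam : I → ℤ) : ℕ → Set (ℕ →₀ ℤ)
  | 0 => {0}
  | (k+1) => {y | ∃ m : ℕ, ∃ x ∈ Dem A ι lam k,
      (ftil A ι lam (ι (k+1)))^[m] (some x) = some y}

/-- The Coxeter matrix entry attached to a generalized Cartan matrix:
`m_{ij} = 2, 3, 4, 6, ∞(=0)` according as `a_{ij} a_{ji} = 0, 1, 2, 3, ≥ 4`. -/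
def coxEntry (A : I → I → ℤ) (i j : I) : ℕ :=
  if i = j then 1
  else if A i j * A j i = 0 then 2
  else if A i j * A j i = 1 then 3
  else if A i j * A j i = 2 then 4
  else if A i j * A j i = 3 then 6
  else 0

/-- The Coxeter matrix of the Weyl group of a generalized Cartan matrix `A`. -/
def coxOf (A : I → I → ℤ) : CoxeterMatrix I where
  M := Matrix.of fun i j => coxEntry A i j
  isSymm := by
    ext i j
    by_cases h : i = j
    · simp [coxEntry, h]
    · simp only [Matrix.transpose_apply, Matrix.of_apply, coxEntry, if_neg h,
        if_neg (Ne.symm h), mul_comm (A i j) (A j i)]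
  diagonal i := by simp [coxEntry]
  off_diagonal i j h := by
    simp only [Matrix.of_apply, coxEntry, if_neg h]
    split_ifs <;> decide

/-- The word `i_L, i_{L-1}, …, i_1` (the first `L` letters of `ι`, read backwards). -/
def demWord (ι : ℕ → I) (L : ℕ) : List I :=
  (List.range L).map (fun k => ι (L - k))

/-- `k^{(-)} = max { l : 1 ≤ l < k, i_l = i_k }` (`0` if there is no such `l`). -/
def kminus (ι : ℕ → I) (k : ℕ) : ℕ :=
  sSup {l | 1 ≤ l ∧ l < k ∧ ι l = ι k}

/-- The function `β_k^{(-)}`: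
`β_k^{(-)}(x) = x_{k^{(-)}} + Σ_{k^{(-)}<j<k} a_{i_k i_j} x_j + x_k` if `k^{(-)} > 0`, and
`β_k^{(-)}(x) = -λ_{i_k} + Σ_{1≤j<k} a_{i_k i_j} x_j + x_k` if `k^{(-)} = 0`. -/
def betaME (A : I → I → ℤ) (ι : ℕ → I) (lam : I → ℤ) (k : ℕ) (x : ℕ →₀ ℤ) : ℤ :=
  if kminus ι k = 0 then
    -lam (ι k) + (∑ j ∈ Finset.Ioo 0 k, A (ι k) (ι j) * x j) + x k
  else
    x (kminus ι k) + (∑ j ∈ Finset.Ioo (kminus ι k) k, A (ι k) (ι j) * x j) + x k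

/-- `f̃_i^{max}(x) = f̃_i^{φ_i(x)}(x)`. -/
def ftilMax (A : I → I → ℤ) (ι : ℕ → I) (lam : I → ℤ) (i : I) :
    Option (ℕ →₀ ℤ) → Option (ℕ →₀ ℤ)
  | none => none
  | some x => (ftil A ι lam i)^[(phi A ι lam i x).toNat] (some x)

/-! ### The Weyl group action on weights -/

/-- The simple reflection `s_i` acting on a weight `μ`, recorded by its values `μ j = ⟨h_j, μ⟩`. -/
def weightRefl {I : Type*} (A : I → I → ℤ) (i : I) : Function.End (I → ℤ) :=
  fun μ j => μ j - A j i * μ i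

theorem weightRefl_apply {I : Type*} (A : I → I → ℤ) (i : I) (μ : I → ℤ) (j : I) :
    weightRefl A i μ j = μ j - A j i * μ i := rfl

theorem end_one_apply {X : Type*} (x : X) : (1 : Function.End X) x = x := rfl

theorem end_mul_apply {X : Type*} (f g : Function.End X) (x : X) : (f * g) x = f (g x) := rfl

/-- The effect of `s_i s_j` on the coefficients `(p, q)` of a weight `μ + p α_i + q α_j`, where
`x = ⟨h_i, μ⟩`, `y = ⟨h_j, μ⟩`, `a = ⟨h_i, α_j⟩` and `b = ⟨h_j, α_i⟩`. -/
def rankTwoStep (a b x y : ℤ) (v : ℤ × ℤ) : ℤ × ℤ :=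
  (-x - v.1 + a * (y + b * v.1 + v.2), -y - b * v.1 - v.2)

theorem weightRefl_mul_pow_apply {I : Type*} {A : I → I → ℤ} (hAdiag : ∀ i, A i i = 2) (i j : I)
    (μ : I → ℤ) (n : ℕ) (k : I) :
    ((weightRefl A i * weightRefl A j) ^ n) μ k =
      μ k + A k i * ((rankTwoStep (A i j) (A j i) (μ i) (μ j))^[n] (0, 0)).1
        + A k j * ((rankTwoStep (A i j) (A j i) (μ i) (μ j))^[n] (0, 0)).2 := by
  induction n generalizing k with
  | zero => simp [end_one_apply]
  | succ n ih =>
    rw [pow_succ', Function.iterate_succ_apply']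
    simp only [end_mul_apply, weightRefl_apply, ih, rankTwoStep, hAdiag]
    ring

theorem rankTwoStep_iterate_eq_zero {a b : ℤ} {m : ℕ}
    (h : (a = 0 ∧ b = 0 ∧ m = 2) ∨ (a = -1 ∧ b = -1 ∧ m = 3) ∨ (a = -1 ∧ b = -2 ∧ m = 4) ∨
      (a = -2 ∧ b = -1 ∧ m = 4) ∨ (a = -1 ∧ b = -3 ∧ m = 6) ∨ (a = -3 ∧ b = -1 ∧ m = 6))
    (x y : ℤ) : (rankTwoStep a b x y)^[m] (0, 0) = (0, 0) := by
  rcases h with ⟨rfl, rfl, rfl⟩ | ⟨rfl, rfl, rfl⟩ | ⟨rfl, rfl, rfl⟩ | ⟨rfl, rfl, rfl⟩ |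
    ⟨rfl, rfl, rfl⟩ | ⟨rfl, rfl, rfl⟩ <;>
  simp only [Function.iterate_succ, Function.iterate_zero, Function.comp_apply, id,
    rankTwoStep, Prod.mk.injEq] <;> constructor <;> ring

theorem coxEntry_cases {I : Type*} [DecidableEq I] {A : I → I → ℤ}
    (hAoff : ∀ i j, i ≠ j → A i j ≤ 0) (hAzero : ∀ i j, A i j = 0 ↔ A j i = 0)
    {i j : I} (hij : i ≠ j) :
    ((A i j = 0 ∧ A j i = 0 ∧ coxEntry A i j = 2) ∨
      (A i j = -1 ∧ A j i = -1 ∧ coxEntry A i j = 3) ∨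
      (A i j = -1 ∧ A j i = -2 ∧ coxEntry A i j = 4) ∨
      (A i j = -2 ∧ A j i = -1 ∧ coxEntry A i j = 4) ∨
      (A i j = -1 ∧ A j i = -3 ∧ coxEntry A i j = 6) ∨
      (A i j = -3 ∧ A j i = -1 ∧ coxEntry A i j = 6)) ∨
    (4 ≤ A i j * A j i ∧ coxEntry A i j = 0) := by
  have ha := hAoff i j hij
  have hb := hAoff j i hij.symm
  have h0 := hAzero i j
  rw [coxEntry, if_neg hij]
  generalize A i j = a at *
  generalize A j i = b at *
  by_cases h4 : 4 ≤ a * b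
  · right
    refine ⟨h4, ?_⟩
    split_ifs <;> first | rfl | omega
  left
  rcases eq_or_lt_of_le ha with rfl | ha'
  · simp [h0.1 rfl]
  have hb' : b < 0 := lt_of_le_of_ne hb fun h => ha'.ne (h0.2 h)
  have hal : -3 ≤ a := by nlinarith
  have hbl : -3 ≤ b := by nlinarith
  interval_cases a <;> interval_cases b <;> simp_all

theorem weightRefl_isLiftable {I : Type*} [DecidableEq I] {A : I → I → ℤ}
    (hAdiag : ∀ i, A i i = 2) (hAoff : ∀ i j, i ≠ j → A i j ≤ 0)
    (hAzero : ∀ i j, A i j = 0 ↔ A j i = 0) :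
    (coxOf A).IsLiftable (weightRefl A) := by
  intro i j
  change (weightRefl A i * weightRefl A j) ^ coxEntry A i j = 1
  by_cases hij : i = j
  · subst hij
    funext μ k
    rw [coxEntry, if_pos rfl, pow_one]
    simp only [end_mul_apply, end_one_apply, weightRefl_apply, hAdiag]
    ring
  · rcases coxEntry_cases hAoff hAzero hij with h | ⟨-, h⟩
    · funext μ k
      rw [weightRefl_mul_pow_apply hAdiag, rankTwoStep_iterate_eq_zero h]
      simp [end_one_apply]
    · rw [h, pow_zero]

/-! ### Dominance and descents -/

/-- The word of length `n` that alternates between `i` and `j`, beginning with `i`. -/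
def altWord {I : Type*} (i j : I) : ℕ → List I
  | 0 => []
  | n + 1 => i :: altWord j i n

theorem altWord_eq_alternatingWord {I : Type*} (i j : I) (n : ℕ) :
    altWord i j n = if Even n then CoxeterSystem.alternatingWord i j n
      else CoxeterSystem.alternatingWord j i n := by
  induction n generalizing i j with
  | zero => simp [altWord, CoxeterSystem.alternatingWord]
  | succ n ih =>
    rw [altWord, ih]
    by_cases hn : Even n <;>
      simp [hn, Nat.even_add_one, CoxeterSystem.alternatingWord_succ']

theorem length_altWord {I : Type*} (i j : I) (n : ℕ) : (altWord i j n).length = n := by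
  induction n generalizing i j with
  | zero => rfl
  | succ n ih => simp [altWord, ih]

theorem le_of_isReduced_altWord {I W : Type*} [Group W] {M : CoxeterMatrix I}
    (cs : CoxeterSystem M W) {i j : I} {n : ℕ} (h : cs.IsReduced (altWord i j n))
    (hM : M i j ≠ 0) : n ≤ M i j := by
  by_contra! hn
  rw [altWord_eq_alternatingWord] at h
  split_ifs at h
  · exact cs.not_isReduced_alternatingWord i j hM hn h
  · rw [M.symmetric] at hM hn
    exact cs.not_isReduced_alternatingWord j i hM hn h

/-- Splitting off the longest alternating prefix in two letters. -/
theorem exists_altWord_mul {I W : Type*} [Group W] {M : CoxeterMatrix I}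
    (cs : CoxeterSystem M W) (w : W) (i j : I) (hi : ¬ cs.IsLeftDescent w i) :
    ∃ (n : ℕ) (v : W), w = cs.wordProd (altWord j i n) * v ∧ cs.length w = n + cs.length v ∧
      ¬ cs.IsLeftDescent v i ∧ ¬ cs.IsLeftDescent v j := by
  induction hl : cs.length w using Nat.strong_induction_on generalizing w i j with
  | _ l ih =>
    by_cases hj : cs.IsLeftDescent w j
    · obtain ⟨n, v, hw, hlen, hvj, hvi⟩ := ih (cs.length (cs.simple j * w)) (hl ▸ hj)
        (cs.simple j * w) j i (cs.isLeftDescent_iff_not_isLeftDescent_mul.1 hj) rfl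
      refine ⟨n + 1, v, ?_, ?_, hvi, hvj⟩
      · rw [altWord, cs.wordProd_cons, mul_assoc, ← hw, cs.simple_mul_simple_cancel_left]
      · have := cs.isLeftDescent_iff.1 hj
        omega
    · exact ⟨0, w, by simp [altWord], by omega, hi, hj⟩

theorem altWord_isReduced {I W : Type*} [Group W] {M : CoxeterMatrix I}
    (cs : CoxeterSystem M W) {w v : W} {i j : I} {n : ℕ} (hi : ¬ cs.IsLeftDescent w i)
    (hw : w = cs.wordProd (altWord j i n) * v) (hlen : cs.length w = n + cs.length v) :
    cs.IsReduced (altWord i j (n + 1)) := by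
  have h1 := cs.not_isLeftDescent_iff.1 hi
  have h2 := cs.length_mul_le (cs.wordProd (altWord i j (n + 1))) v
  have h3 := cs.length_wordProd_le (altWord i j (n + 1))
  rw [altWord, cs.wordProd_cons, mul_assoc, ← hw] at h2
  rw [length_altWord] at h3
  rw [CoxeterSystem.IsReduced, length_altWord]
  rw [altWord, cs.wordProd_cons] at h3 ⊢
  omega

/-- Positivity for rank two: a weight dominant for `i, j` stays nonnegative on `h_i` after applying
an alternating word beginning with `j`, as long as prepending `i` may leave the word reduced. -/
theorem altWord_apply_nonneg {I : Type*} [DecidableEq I] {A : I → I → ℤ}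
    (hAdiag : ∀ i, A i i = 2) (hAoff : ∀ i j, i ≠ j → A i j ≤ 0)
    (hAzero : ∀ i j, A i j = 0 ↔ A j i = 0) {i j : I} (hij : i ≠ j) {n : ℕ}
    (hn : coxEntry A i j ≠ 0 → n + 1 ≤ coxEntry A i j) {μ : I → ℤ} (hi : 0 ≤ μ i) (hj : 0 ≤ μ j) :
    0 ≤ ((altWord j i n).map (weightRefl A)).prod μ i := by
  rcases coxEntry_cases hAoff hAzero hij with h | ⟨h4, -⟩
  · rcases h with ⟨ha, hb, hm⟩ | ⟨ha, hb, hm⟩ | ⟨ha, hb, hm⟩ | ⟨ha, hb, hm⟩ | ⟨ha, hb, hm⟩ |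
      ⟨ha, hb, hm⟩ <;>
    · rw [hm] at hn
      have hn5 : n ≤ 5 := by
        have := hn (by norm_num)
        omega
      interval_cases n <;> first
        | omega
        | (simp only [altWord, List.map_cons, List.map_nil, List.prod_cons, List.prod_nil,
            end_mul_apply, end_one_apply, weightRefl_apply, ha, hb, hAdiag]
           omega)
  · clear hn
    suffices h : ∀ (n : ℕ) (i j : I), i ≠ j → 4 ≤ A i j * A j i → 0 ≤ μ i → 0 ≤ μ j →
        0 ≤ ((altWord j i n).map (weightRefl A)).prod μ i ∧
        0 ≤ 2 * ((altWord j i n).map (weightRefl A)).prod μ j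
          - A j i * ((altWord j i n).map (weightRefl A)).prod μ i from
      (h n i j hij h4 hi hj).1
    clear h4 hi hj hij i j n
    intro n
    induction n with
    | zero =>
      intro i j hij _ hi hj
      have := hAoff j i hij.symm
      simp only [altWord, List.map_nil, List.prod_nil, end_one_apply]
      exact ⟨hi, by nlinarith⟩
    | succ n ih =>
      intro i j hij h4 hi hj
      obtain ⟨h1, h2⟩ := ih j i hij.symm (by rwa [mul_comm]) hj hi
      have ha := hAoff i j hij
      have hb := hAoff j i hij.symm
      simp only [altWord, List.map_cons, List.prod_cons, end_mul_apply, weightRefl_apply, hAdiag]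
      generalize ((altWord i j n).map (weightRefl A)).prod μ i = x at *
      generalize ((altWord i j n).map (weightRefl A)).prod μ j = y at *
      constructor
      · nlinarith
      · nlinarith [mul_nonneg (neg_nonneg.2 hb) h2, mul_nonneg (sub_nonneg.2 h4) h1]

/-- If `i` is not a left descent of `w`, then `⟨h_i, w λ⟩ ≥ 0` for dominant `λ`. -/
theorem lift_weightRefl_apply_nonneg {I W : Type*} [DecidableEq I] [Group W] {A : I → I → ℤ}
    (hAdiag : ∀ i, A i i = 2) (hAoff : ∀ i j, i ≠ j → A i j ≤ 0)
    (hAzero : ∀ i j, A i j = 0 ↔ A j i = 0) (cs : CoxeterSystem (coxOf A) W)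
    {lam : I → ℤ} (hlam : ∀ i, 0 ≤ lam i) (w : W) (i : I) (hi : ¬ cs.IsLeftDescent w i) :
    0 ≤ cs.lift ⟨weightRefl A, weightRefl_isLiftable hAdiag hAoff hAzero⟩ w lam i := by
  induction hl : cs.length w using Nat.strong_induction_on generalizing w i with
  | _ l ih =>
    by_cases hw1 : w = 1
    · subst hw1
      simpa [end_one_apply] using hlam i
    obtain ⟨j, hj⟩ := cs.exists_leftDescent_of_ne_one hw1
    have hij : i ≠ j := fun h => hi (h ▸ hj)
    obtain ⟨n, v, hw, hlen, hvi, hvj⟩ := exists_altWord_mul cs w i j hi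
    have hn : n ≠ 0 := by
      rintro rfl
      simp only [altWord, CoxeterSystem.wordProd_nil, one_mul] at hw
      exact hvj (hw ▸ hj)
    have hred := altWord_isReduced cs hi hw hlen
    have key := altWord_apply_nonneg hAdiag hAoff hAzero hij
      (fun h => le_of_isReduced_altWord cs hred h)
      (ih _ (by omega) v i hvi rfl) (ih _ (by omega) v j hvj rfl)
    rw [hw, map_mul, end_mul_apply, CoxeterSystem.wordProd, map_list_prod, List.map_map]
    convert key using 4
    exact funext fun k =>
      cs.lift_apply_simple (weightRefl_isLiftable hAdiag hAoff hAzero) k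

/-! ### The solution of the linear system -/

/-- The weight `s_{i_k} ⋯ s_{i_1} λ`. -/
def demWeight {I : Type*} (A : I → I → ℤ) (ι : ℕ → I) (lam : I → ℤ) : ℕ → I → ℤ
  | 0 => lam
  | k + 1 => weightRefl A (ι (k + 1)) (demWeight A ι lam k)

/-- The number `⟨h_{i_k}, s_{i_{k-1}} ⋯ s_{i_1} λ⟩`, for `k ≥ 1`. -/
def demCoeff {I : Type*} (A : I → I → ℤ) (ι : ℕ → I) (lam : I → ℤ) : ℕ → ℤ
  | 0 => 0
  | k + 1 => demWeight A ι lam k (ι (k + 1))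

/-- The vector whose first `L` entries are `demCoeff 1, …, demCoeff L`. -/
def demVec {I : Type*} (A : I → I → ℤ) (ι : ℕ → I) (lam : I → ℤ) : ℕ → ℕ →₀ ℤ
  | 0 => 0
  | k + 1 => demVec A ι lam k + Finsupp.single (k + 1) (demCoeff A ι lam (k + 1))

theorem demVec_apply {I : Type*} (A : I → I → ℤ) (ι : ℕ → I) (lam : I → ℤ) (L k : ℕ) :
    demVec A ι lam L k = if k ≤ L then demCoeff A ι lam k else 0 := by
  induction L with
  | zero => rcases k with _ | k <;> simp [demVec, demCoeff]
  | succ L ih =>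
    rw [demVec, Finsupp.add_apply, ih, Finsupp.single_apply]
    rcases lt_trichotomy k (L + 1) with h | rfl | h
    · rw [if_pos (by omega), if_neg (by omega), if_pos (by omega), add_zero]
    · simp
    · rw [if_neg (by omega), if_neg (by omega), if_neg (by omega), add_zero]

theorem demWeight_eq_sub_sum {I : Type*} (A : I → I → ℤ) (ι : ℕ → I) (lam : I → ℤ) {l k : ℕ}
    (h : l ≤ k) (i : I) :
    demWeight A ι lam k i =
      demWeight A ι lam l i - ∑ j ∈ Finset.Ioc l k, A i (ι j) * demCoeff A ι lam j := by
  induction k, h using Nat.le_induction with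
  | base => simp
  | succ k h ih =>
    rw [Finset.sum_Ioc_succ_top h, demWeight, weightRefl_apply, ih, demCoeff]
    ring

theorem demCoeff_add_sum {I : Type*} {A : I → I → ℤ} (hAdiag : ∀ i, A i i = 2) (ι : ℕ → I)
    (lam : I → ℤ) {l k : ℕ} (hl : 1 ≤ l) (h : l ≤ k) :
    demCoeff A ι lam l + ∑ j ∈ Finset.Ioc l k, A (ι l) (ι j) * demCoeff A ι lam j =
      -demWeight A ι lam k (ι l) := by
  obtain ⟨l, rfl⟩ := Nat.exists_eq_add_of_le' hl
  rw [demWeight_eq_sub_sum A ι lam h, demWeight, weightRefl_apply, demCoeff, hAdiag]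
  ring

theorem kminus_spec {I : Type*} (ι : ℕ → I) {k : ℕ} (h : kminus ι k ≠ 0) :
    1 ≤ kminus ι k ∧ kminus ι k < k ∧ ι (kminus ι k) = ι k := by
  have hne : {l | 1 ≤ l ∧ l < k ∧ ι l = ι k}.Nonempty := by
    by_contra hne
    rw [Set.not_nonempty_iff_eq_empty] at hne
    exact h (by rw [kminus, hne, csSup_empty]; rfl)
  exact Nat.sSup_mem hne ⟨k, fun l hl => hl.2.1.le⟩

theorem betaME_sub_self_congr {I : Type*} (A : I → I → ℤ) (ι : ℕ → I) (lam : I → ℤ) {k : ℕ}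
    {x y : ℕ →₀ ℤ} (h : ∀ j < k, x j = y j) :
    betaME A ι lam k x - x k = betaME A ι lam k y - y k := by
  have hs : ∀ l, ∑ j ∈ Finset.Ioo l k, A (ι k) (ι j) * x j =
      ∑ j ∈ Finset.Ioo l k, A (ι k) (ι j) * y j := fun l =>
    Finset.sum_congr rfl fun j hj => by rw [h j (Finset.mem_Ioo.1 hj).2]
  unfold betaME
  split_ifs with h0
  · rw [hs]; ring
  · rw [hs, h _ (kminus_spec ι h0).2.1]; ring

theorem betaME_demVec {I : Type*} {A : I → I → ℤ} (hAdiag : ∀ i, A i i = 2) (ι : ℕ → I)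
    (lam : I → ℤ) {L k : ℕ} (hk : 1 ≤ k) (hkL : k ≤ L) :
    betaME A ι lam k (demVec A ι lam L) = 0 := by
  obtain ⟨k, rfl⟩ := Nat.exists_eq_add_of_le' hk
  have hs : ∀ l, ∑ j ∈ Finset.Ioo l (k + 1), A (ι (k + 1)) (ι j) * demVec A ι lam L j =
      ∑ j ∈ Finset.Ioc l k, A (ι (k + 1)) (ι j) * demCoeff A ι lam j := fun l => by
    refine Finset.sum_congr (by ext; simp) fun j hj => ?_
    rw [demVec_apply, if_pos]
    have := (Finset.mem_Ioc.1 hj).2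
    omega
  unfold betaME
  split_ifs with h0
  · rw [hs, demVec_apply, if_pos hkL, demCoeff, demWeight_eq_sub_sum A ι lam (Nat.zero_le k),
      demWeight]
    ring
  · obtain ⟨h1, h2, h3⟩ := kminus_spec ι h0
    have := demCoeff_add_sum hAdiag ι lam h1 (Nat.lt_succ_iff.1 h2)
    rw [h3] at this
    rw [hs, demVec_apply, demVec_apply, if_pos hkL, if_pos (by omega), this, demCoeff]
    ring

theorem eq_of_betaME_eq_zero {I : Type*} (A : I → I → ℤ) (ι : ℕ → I) (lam : I → ℤ) {L : ℕ}
    {x y : ℕ →₀ ℤ} (hx0 : x 0 = 0) (hy0 : y 0 = 0) (hxL : ∀ k, L < k → x k = 0)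
    (hyL : ∀ k, L < k → y k = 0) (hx : ∀ k, 1 ≤ k → k ≤ L → betaME A ι lam k x = 0)
    (hy : ∀ k, 1 ≤ k → k ≤ L → betaME A ι lam k y = 0) : x = y := by
  ext k
  induction k using Nat.strong_induction_on with
  | _ k ih =>
    rcases Nat.eq_zero_or_pos k with rfl | hk
    · rw [hx0, hy0]
    by_cases hkL : k ≤ L
    · have := betaME_sub_self_congr A ι lam ih
      rw [hx k hk hkL, hy k hk hkL] at this
      linarith
    · rw [hxL k (not_le.1 hkL), hyL k (not_le.1 hkL)]

/-! ### The Kashiwara operators on the partial solutions -/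

theorem sum_support_filter_lt_eq_sum_Ioc (f : ℕ → ℤ) (k : ℕ) {x : ℕ →₀ ℤ} {N : ℕ}
    (hx : ∀ j, N < j → x j = 0) :
    ∑ j ∈ x.support.filter (fun j => k < j), f j * x j = ∑ j ∈ Finset.Ioc k N, f j * x j := by
  refine Finset.sum_subset (fun j hj => ?_) fun j hj hj' => ?_
  · rw [Finset.mem_filter, Finsupp.mem_support_iff] at hj
    exact Finset.mem_Ioc.2 ⟨hj.2, by_contra fun h => hj.1 (hx j (not_le.1 h))⟩
  · simp only [Finset.mem_filter, Finsupp.mem_support_iff, not_and_or, not_not] at hj'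
    rw [hj'.resolve_right (not_not.2 (Finset.mem_Ioc.1 hj).1), mul_zero]

theorem sig_eq_sum_Ioc {I : Type*} (A : I → I → ℤ) (ι : ℕ → I) (k : ℕ) {x : ℕ →₀ ℤ} {N : ℕ}
    (hx : ∀ j, N < j → x j = 0) :
    sig A ι k x = x k + ∑ j ∈ Finset.Ioc k N, A (ι k) (ι j) * x j := by
  rw [sig, sum_support_filter_lt_eq_sum_Ioc (fun j => A (ι k) (ι j)) k hx]

theorem sig0_eq_sum_Ioc {I : Type*} (A : I → I → ℤ) (ι : ℕ → I) (lam : I → ℤ) (i : I)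
    {x : ℕ →₀ ℤ} {N : ℕ} (hx : ∀ j, N < j → x j = 0) :
    sig0 A ι lam i x = -lam i + ∑ j ∈ Finset.Ioc 0 N, A i (ι j) * x j :=
  congrArg (-lam i + ·) (sum_support_filter_lt_eq_sum_Ioc (fun j => A i (ι j)) 0 hx)

theorem demVec_add_single_apply {I : Type*} (A : I → I → ℤ) (ι : ℕ → I) (lam : I → ℤ)
    (k : ℕ) (m : ℤ) (j : ℕ) :
    (demVec A ι lam k + Finsupp.single (k + 1) m) j =
      if j ≤ k then demCoeff A ι lam j else if j = k + 1 then m else 0 := by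
  rw [Finsupp.add_apply, demVec_apply, Finsupp.single_apply]
  rcases lt_trichotomy j (k + 1) with h | rfl | h
  · rw [if_pos (by omega), if_neg (by omega), if_pos (by omega), add_zero]
  · simp
  · rw [if_neg (by omega), if_neg (by omega), if_neg (by omega), if_neg (by omega), add_zero]

theorem demVec_add_single_eq_zero {I : Type*} (A : I → I → ℤ) (ι : ℕ → I) (lam : I → ℤ)
    (k : ℕ) (m : ℤ) (j : ℕ) (hj : k + 1 < j) :
    (demVec A ι lam k + Finsupp.single (k + 1) m) j = 0 := by
  rw [demVec_add_single_apply, if_neg (by omega), if_neg (by omega)]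

theorem sum_Ioc_demVec_add_single {I : Type*} {A : I → I → ℤ} (hAdiag : ∀ i, A i i = 2) (ι : ℕ → I) (lam : I → ℤ)
    (k : ℕ) (m : ℤ) {l : ℕ} (hl : l ≤ k) :
    ∑ j ∈ Finset.Ioc l (k + 1), A (ι (k + 1)) (ι j) *
        (demVec A ι lam k + Finsupp.single (k + 1) m) j =
      ∑ j ∈ Finset.Ioc l k, A (ι (k + 1)) (ι j) * demCoeff A ι lam j + 2 * m := by
  rw [Finset.sum_Ioc_succ_top hl, hAdiag, demVec_add_single_apply, if_neg (by omega), if_pos rfl]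
  congr 1
  refine Finset.sum_congr rfl fun j hj => ?_
  rw [demVec_add_single_apply, if_pos (Finset.mem_Ioc.1 hj).2]

theorem sig0_demVec_add_single {I : Type*} {A : I → I → ℤ} (hAdiag : ∀ i, A i i = 2) (ι : ℕ → I) (lam : I → ℤ)
    (k : ℕ) (m : ℤ) :
    sig0 A ι lam (ι (k + 1)) (demVec A ι lam k + Finsupp.single (k + 1) m) =
      2 * m - demCoeff A ι lam (k + 1) := by
  rw [sig0_eq_sum_Ioc A ι lam _ (demVec_add_single_eq_zero A ι lam k m),
    sum_Ioc_demVec_add_single hAdiag ι lam k m (Nat.zero_le k), demCoeff,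
    demWeight_eq_sub_sum A ι lam (Nat.zero_le k), demWeight]
  ring

theorem sig_demVec_add_single_of_lt {I : Type*} {A : I → I → ℤ} (hAdiag : ∀ i, A i i = 2) (ι : ℕ → I) (lam : I → ℤ)
    (k : ℕ) (m : ℤ) {l : ℕ} (hl1 : 1 ≤ l) (hl : l < k + 1)
    (hι : ι l = ι (k + 1)) :
    sig A ι l (demVec A ι lam k + Finsupp.single (k + 1) m) =
      2 * m - demCoeff A ι lam (k + 1) := by
  have h := demCoeff_add_sum hAdiag ι lam hl1 (Nat.lt_succ_iff.1 hl)
  rw [hι] at h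
  rw [sig_eq_sum_Ioc A ι _ (demVec_add_single_eq_zero A ι lam k m), hι,
    sum_Ioc_demVec_add_single hAdiag ι lam k m (by omega), demVec_add_single_apply,
    if_pos (by omega), ← add_assoc, h, demCoeff]
  ring

theorem sig_demVec_add_single_self {I : Type*} (A : I → I → ℤ) (ι : ℕ → I) (lam : I → ℤ)
    (k : ℕ) (m : ℤ) :
    sig A ι (k + 1) (demVec A ι lam k + Finsupp.single (k + 1) m) = m := by
  rw [sig_eq_sum_Ioc A ι _ (demVec_add_single_eq_zero A ι lam k m), demVec_add_single_apply]
  simp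

theorem sig_demVec_add_single_of_gt {I : Type*} (A : I → I → ℤ) (ι : ℕ → I) (lam : I → ℤ)
    (k : ℕ) (m : ℤ) {l : ℕ} (hl : k + 1 < l) :
    sig A ι l (demVec A ι lam k + Finsupp.single (k + 1) m) = 0 := by
  rw [sig_eq_sum_Ioc A ι _ (demVec_add_single_eq_zero A ι lam k m),
    demVec_add_single_eq_zero A ι lam k m l hl, Finset.Ioc_eq_empty (by omega),
    Finset.sum_empty, add_zero]

theorem sigMax_demVec_add_single {I : Type*} {A : I → I → ℤ} (hAdiag : ∀ i, A i i = 2)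
    (ι : ℕ → I) (lam : I → ℤ) (k : ℕ) {m : ℤ} (hm : 0 ≤ m)
    (hmc : m ≤ demCoeff A ι lam (k + 1)) :
    sigMax A ι (ι (k + 1)) (demVec A ι lam k + Finsupp.single (k + 1) m) = m := by
  refine IsGreatest.csSup_eq ⟨⟨k + 1, ⟨by omega, rfl⟩, sig_demVec_add_single_self A ι lam k m⟩, ?_⟩
  rintro _ ⟨l, ⟨hl1, hl⟩, rfl⟩
  rcases lt_trichotomy l (k + 1) with h | rfl | h
  · simp only [sig_demVec_add_single_of_lt hAdiag ι lam k m hl1 h hl]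
    linarith
  · exact (sig_demVec_add_single_self A ι lam k m).le
  · simpa only [sig_demVec_add_single_of_gt A ι lam k m h] using hm

theorem sInf_Mset_demVec_add_single {I : Type*} {A : I → I → ℤ} (hAdiag : ∀ i, A i i = 2)
    (ι : ℕ → I) (lam : I → ℤ) (k : ℕ) {m : ℤ} (hm : 0 ≤ m)
    (hmc : m < demCoeff A ι lam (k + 1)) :
    sInf (Mset A ι (ι (k + 1)) (demVec A ι lam k + Finsupp.single (k + 1) m)) = k + 1 := by
  have hmax := sigMax_demVec_add_single hAdiag ι lam k hm hmc.le
  refine IsLeast.csInf_eq ⟨⟨by omega, rfl, ?_⟩, ?_⟩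
  · rw [hmax, sig_demVec_add_single_self]
  · rintro l ⟨hl1, hl, hsig⟩
    by_contra! h
    rw [hmax, sig_demVec_add_single_of_lt hAdiag ι lam k m hl1 h hl] at hsig
    linarith

theorem ftil_iterate_demVec {I : Type*} {A : I → I → ℤ} (hAdiag : ∀ i, A i i = 2)
    (ι : ℕ → I) (lam : I → ℤ) (k n : ℕ) (hn : (n : ℤ) ≤ demCoeff A ι lam (k + 1)) :
    (ftil A ι lam (ι (k + 1)))^[n] (some (demVec A ι lam k)) =
      some (demVec A ι lam k + Finsupp.single (k + 1) (n : ℤ)) := by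
  induction n with
  | zero => simp
  | succ n ih =>
    push_cast at hn
    have hn' : (n : ℤ) < demCoeff A ι lam (k + 1) := by omega
    have hn0 : (0 : ℤ) ≤ n := n.cast_nonneg
    rw [Function.iterate_succ_apply', ih hn'.le, ftil, if_pos,
      sInf_Mset_demVec_add_single hAdiag ι lam k hn0 hn', add_assoc, ← Finsupp.single_add,
      Nat.cast_succ]
    rw [sig0_demVec_add_single hAdiag, sigMax_demVec_add_single hAdiag ι lam k hn0 hn'.le]
    linarith

theorem ftilMax_demVec {I : Type*} {A : I → I → ℤ} (hAdiag : ∀ i, A i i = 2)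
    (ι : ℕ → I) (lam : I → ℤ) (k : ℕ) (hc : 0 ≤ demCoeff A ι lam (k + 1)) :
    ftilMax A ι lam (ι (k + 1)) (some (demVec A ι lam k)) = some (demVec A ι lam (k + 1)) := by
  have hphi : phi A ι lam (ι (k + 1)) (demVec A ι lam k) = demCoeff A ι lam (k + 1) := by
    have h0 := sig0_demVec_add_single hAdiag ι lam k 0
    have h1 := sigMax_demVec_add_single hAdiag ι lam k le_rfl hc
    rw [Finsupp.single_zero, add_zero] at h0 h1
    rw [phi, eps, h0, h1, max_eq_left (by linarith)]
    ring
  rw [ftilMax, hphi, ftil_iterate_demVec hAdiag ι lam k _ (Int.toNat_of_nonneg hc).le,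
    Int.toNat_of_nonneg hc, demVec]

theorem foldl_ftilMax_eq_demVec {I : Type*} {A : I → I → ℤ} (hAdiag : ∀ i, A i i = 2)
    (ι : ℕ → I) (lam : I → ℤ) {L : ℕ} (hc : ∀ k < L, 0 ≤ demCoeff A ι lam (k + 1)) :
    List.foldl (fun y k => ftilMax A ι lam (ι k) y) (some 0) (List.range' 1 L) =
      some (demVec A ι lam L) := by
  induction L with
  | zero => rfl
  | succ L ih =>
    rw [List.range'_1_concat, List.foldl_append, ih fun k hk => hc k (by omega),
      List.foldl_cons, List.foldl_nil, add_comm 1 L,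
      ftilMax_demVec hAdiag ι lam L (hc L (by omega))]

/-! ### Nonnegativity from reducedness -/

theorem demWord_succ {I : Type*} (ι : ℕ → I) (L : ℕ) :
    demWord ι (L + 1) = ι (L + 1) :: demWord ι L := by
  simp [demWord, List.range_succ_eq_map, Function.comp_def]

theorem demWord_isReduced_of_le {I W : Type*} [Group W] {M : CoxeterMatrix I}
    {cs : CoxeterSystem M W} {ι : ℕ → I} {k L : ℕ} (hL : cs.IsReduced (demWord ι L))
    (h : k ≤ L) : cs.IsReduced (demWord ι k) := by
  induction L, h using Nat.le_induction with
  | base => exact hL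
  | succ L _ ih =>
    rw [demWord_succ] at hL
    exact ih (hL.drop 1)

theorem lift_weightRefl_wordProd_demWord {I W : Type*} [DecidableEq I] [Group W] {A : I → I → ℤ}
    (cs : CoxeterSystem (coxOf A) W) (hA : (coxOf A).IsLiftable (weightRefl A)) (ι : ℕ → I)
    (lam : I → ℤ) (k : ℕ) :
    cs.lift ⟨weightRefl A, hA⟩ (cs.wordProd (demWord ι k)) lam = demWeight A ι lam k := by
  induction k with
  | zero => simp [demWord, demWeight, end_one_apply]
  | succ k ih =>
    rw [demWord_succ, cs.wordProd_cons, map_mul, cs.lift_apply_simple hA, end_mul_apply, ih,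
      demWeight]

theorem demCoeff_nonneg {I W : Type*} [DecidableEq I] [Group W] {A : I → I → ℤ}
    (hAdiag : ∀ i, A i i = 2) (hAoff : ∀ i j, i ≠ j → A i j ≤ 0)
    (hAzero : ∀ i j, A i j = 0 ↔ A j i = 0) {cs : CoxeterSystem (coxOf A) W} {ι : ℕ → I}
    {lam : I → ℤ} (hlam : ∀ i, 0 ≤ lam i) {k : ℕ} (hk : cs.IsReduced (demWord ι (k + 1))) :
    0 ≤ demCoeff A ι lam (k + 1) := by
  have hA := weightRefl_isLiftable hAdiag hAoff hAzero
  have hk' := (demWord_isReduced_of_le hk (Nat.le_succ k)).eq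
  rw [CoxeterSystem.IsReduced, demWord_succ, cs.wordProd_cons, List.length_cons, ← hk'] at hk
  rw [demCoeff, ← lift_weightRefl_wordProd_demWord cs hA]
  exact lift_weightRefl_apply_nonneg hAdiag hAoff hAzero cs hlam _ _
    (cs.not_isLeftDescent_iff.2 hk)

/-- For a reduced word `w = s_{i_L}⋯s_{i_1}` whose letters are the first `L`
terms of `ι`, the element `x_w = f̃_{i_L}^{max} ⋯ f̃_{i_1}^{max}(0̄)` (the image of the extremal
vector `u_{wλ}`) is nonzero, and is the unique solution of the system
`{ x_k = 0 for k > L, β_k^{(-)}(x) = 0 for 1 ≤ k ≤ L }`. -/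
theorem extremal_vector_unique_solution {I : Type*} [Fintype I] [DecidableEq I]
    (A : I → I → ℤ)
    (hAdiag : ∀ i, A i i = 2)
    (hAoff : ∀ i j, i ≠ j → A i j ≤ 0)
    (hAzero : ∀ i j, A i j = 0 ↔ A j i = 0)
    (hAsym : ∃ d : I → ℤ, (∀ i, 0 < d i) ∧ ∀ i j, d i * A i j = d j * A j i)
    (ι : ℕ → I)
    (hι₁ : ∀ k, 1 ≤ k → ι k ≠ ι (k + 1))
    (hι₂ : ∀ i : I, {k : ℕ | 1 ≤ k ∧ ι k = i}.Infinite)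
    (lam : I → ℤ) (hlam : ∀ i, 0 ≤ lam i)
    (L : ℕ)
    (hred : (coxOf A).toCoxeterSystem.IsReduced (demWord ι L)) :
    ∃ z : ℕ →₀ ℤ,
      List.foldl (fun y k => ftilMax A ι lam (ι k) y) (some 0) (List.range' 1 L) = some z ∧
      ∀ y : ℕ →₀ ℤ,
        (y 0 = 0 ∧ (∀ k, L < k → y k = 0) ∧
          ∀ k, 1 ≤ k → k ≤ L → betaME A ι lam k y = 0) ↔ y = z := by
  refine ⟨demVec A ι lam L, foldl_ftilMax_eq_demVec hAdiag ι lam fun k hk =>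
    demCoeff_nonneg hAdiag hAoff hAzero hlam (demWord_isReduced_of_le hred hk), fun y => ?_⟩
  have h0 : demVec A ι lam L 0 = 0 := by rw [demVec_apply, if_pos (Nat.zero_le L), demCoeff]
  have hL : ∀ k, L < k → demVec A ι lam L k = 0 := fun k hk => by
    rw [demVec_apply, if_neg (not_le.2 hk)]
  have hβ : ∀ k, 1 ≤ k → k ≤ L → betaME A ι lam k (demVec A ι lam L) = 0 := fun k hk hkL =>
    betaME_demVec hAdiag ι lam hk hkL
  constructor
  · rintro ⟨hy0, hyL, hy⟩
    exact eq_of_betaME_eq_zero A ι lam hy0 h0 hyL hL hy hβ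
  · rintro rfl
    exact ⟨h0, hL, hβ⟩

end PaperNakashima
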